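/- For every integer n ≥ 3 and every λ with 1/(n+1) ≤ λ ≤ 1/n, the Shannon entropy difference satisfies H(p(n,λ)) − H(q(n,λ)) ≥ (2/ln 2)·((n+1)(n−2)/(4n(n−1)))²·(1 − 1/n)^{2n} ≥ 32/(6561·ln 2) > 0. -/

import Mathlib

/-- The output distribution p(n,λ) of the general attenuator with Fock environment |n⟩,
for ℓ = 0, …, n+1 (the case ℓ = n+1 is the continuous extension of the formula
… · λ^(n-ℓ) · …, which involves λ⁻¹, valid for all λ ∈ (0,1)). -/
noncomputable def pdist (n ℓ : ℕ) (t : ℝ) : ℝ :=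
  if ℓ ≤ n then
    1 / (2 * ((n : ℝ) + 1) * (1 - t)) * ((n + 1).choose ℓ : ℝ) * (1 - t) ^ ℓ * t ^ (n - ℓ) *
      ((1 - t) * ((n : ℝ) - (ℓ : ℝ) + 1) + (((n : ℝ) + 1) * (1 - t) - (ℓ : ℝ)) ^ 2)
  else ((n : ℝ) + 1) * t * (1 - t) ^ n / 2

/-- The output distribution q(n,λ) (spectrum of the joint output state). -/
noncomputable def qdist (n ℓ : ℕ) (t : ℝ) : ℝ :=
  if ℓ ≤ n then
    1 / (2 * ((n : ℝ) + 1) * (1 - t)) * ((n + 1).choose ℓ : ℝ) * (1 - t) ^ ℓ * t ^ (n - ℓ) *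
      (t * (ℓ : ℝ) + (((n : ℝ) + 1) * (1 - t) - (ℓ : ℝ)) ^ 2)
  else (1 - t) ^ n * (1 + ((n : ℝ) + 1) * t) / 2


/-- Shannon entropy (base 2) of a distribution on {0, ..., n+1}. -/
noncomputable def shannonH (n : ℕ) (r : ℕ → ℝ) : ℝ :=
  -∑ ℓ ∈ Finset.range (n + 2), r ℓ * Real.logb 2 (r ℓ)


lemma polyA (w y : ℝ) (hy : 0 ≤ y) (hyw : y ≤ w) (hw : w ≤ 1/4) :
    2*(1+y)*(1-w*y) + (1+y)*(1+w)*(1-y)^2 ≤ 2*(1-w*y)^2*(3/2+w/2+(19/20)*y) := by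
  have hw0 : 0 ≤ w := hy.trans hyw
  have key : 0 ≤ 9/10 + y - y^2 - 3*w - 2*w^2 - 0.8*(w*y) - w*y^2 := by
    have h1 : w * y ≤ 1/4*y := mul_le_mul_of_nonneg_right hw hy
    have h2 : y * y ≤ 1/4 * y := mul_le_mul_of_nonneg_right (hyw.trans hw) hy
    have h3 : w * w ≤ 1/4 * w := mul_le_mul_of_nonneg_right hw hw0
    have h4 : w * (y*y) ≤ 1/4 * (1/4*y) := mul_le_mul hw h2 (by positivity) (by norm_num)
    nlinarith
  have k2 := mul_nonneg hy key
  have k3 : 0 ≤ (w*y)^2*(3/2+w/2+(19/20)*y) := by positivity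
  nlinarith [k2, k3]

/-- Quadratic upper bound of `x log x - x + 1`. -/
noncomputable def TT (a L : ℝ) : ℝ := L * Real.log a + L^2/a - 2*L + 1

noncomputable def hh (y : ℝ) : ℝ := y * Real.log y - y

lemma hh_tangent (q a : ℝ) (hq : 0 ≤ q) (ha : 0 < a) : q * Real.log a - a ≤ hh q := by
  unfold hh
  rcases hq.eq_or_lt with rfl | hq
  · simp; exact ha.le
  have := Real.log_le_sub_one_of_pos (div_pos ha hq)
  rw [Real.log_div ha.ne' hq.ne'] at this
  have h2 := mul_le_mul_of_nonneg_left this hq.le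
  have : q * (a / q - 1) = a - q := by field_simp
  nlinarith

lemma hh_ge (q : ℝ) (hq : 0 ≤ q) : -1 ≤ hh q := by
  have := hh_tangent q 1 hq one_pos
  simpa using this

lemma hh_le_TT (L a : ℝ) (hL : 0 ≤ L) (ha : 0 < a) : hh L + 1 ≤ TT a L := by
  unfold hh TT
  rcases hL.eq_or_lt with rfl | hL
  · simp
  have := Real.log_le_sub_one_of_pos (div_pos hL ha)
  rw [Real.log_div hL.ne' ha.ne'] at this
  have h2 := mul_le_mul_of_nonneg_left this hL.le
  have : L * (L / a - 1) = L^2/a - L := by ring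
  nlinarith

/-- `hh` is decreasing on `[0,1]`. -/
lemma hh_anti (q p : ℝ) (hq : 0 ≤ q) (hqp : q ≤ p) (hp : p ≤ 1) : hh p ≤ hh q := by
  rcases (hq.trans hqp).eq_or_lt with h | h
  · have : q = p := by linarith
    rw [this]
  have := hh_tangent q p hq h
  have hl := Real.log_nonpos h.le hp
  unfold hh at *
  nlinarith

lemma hh_mono (q p : ℝ) (hq : 1 ≤ q) (hqp : q ≤ p) : hh q ≤ hh p := by
  have := hh_tangent p q (by linarith) (by linarith)
  have hl := Real.log_nonneg hq
  unfold hh at *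
  nlinarith

lemma hh_drop (q p L a : ℝ) (hq : 0 ≤ q) (hqp : q ≤ p) (hpL : p ≤ L) (ha : 0 < a) :
    hh p - hh q ≤ TT a L := by
  have h1 := hh_le_TT L a (by linarith) ha
  have h2 := hh_ge L (by linarith)
  rcases le_total p 1 with h | h
  · have := hh_anti q p hq hqp h
    linarith
  · have := hh_mono p L h hpL
    have := hh_ge q hq
    linarith

/-- Increment for `k = 1`. -/
lemma hh_incr (p v : ℝ) (hp : 1 ≤ p) (hv : 1 ≤ v) : hh v + 1 ≤ hh (p + (v - 1)) - hh p := by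
  have hpos : 0 < p + (v - 1) := by linarith
  have a1 := hh_tangent (p+(v-1)) (p+(v-1)) hpos.le hpos
  unfold hh
  have e1 : Real.log p ≤ Real.log (p + (v-1)) := Real.log_le_log (by linarith) (by linarith)
  have e2 : Real.log v ≤ Real.log (p + (v-1)) := Real.log_le_log (by linarith) (by linarith)
  have b1 : p * (Real.log p - Real.log (p+(v-1))) + v * (Real.log v - Real.log (p+(v-1))) ≤ - Real.log (p+(v-1)) := by
    have hlp : Real.log p + Real.log v ≥ Real.log (p+(v-1)) := by
      rw [← Real.log_mul (by linarith) (by linarith)]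
      exact Real.log_le_log hpos (by nlinarith)
    have c := Real.convexOn_mul_log
    set S := p + (v-1) with hS
    rcases eq_or_lt_of_le (show (1:ℝ) ≤ S by linarith) with h | h
    · have : p = 1 := by linarith
      have : v = 1 := by linarith
      rw [← h, ‹p = 1›, ‹v = 1›]; simp
    have hne : S - 1 ≠ 0 := by linarith
    have hp' := c.2 (show (1:ℝ) ∈ Set.Ici 0 by simp) (show S ∈ Set.Ici 0 from hpos.le)
      (show 0 ≤ (S-p)/(S-1) from div_nonneg (by linarith) (by linarith))
      (show 0 ≤ (p-1)/(S-1) from div_nonneg (by linarith) (by linarith)) (by field_simp; ring)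
    have hv' := c.2 (show (1:ℝ) ∈ Set.Ici 0 by simp) (show S ∈ Set.Ici 0 from hpos.le)
      (show 0 ≤ (S-v)/(S-1) from div_nonneg (by linarith) (by linarith))
      (show 0 ≤ (v-1)/(S-1) from div_nonneg (by linarith) (by linarith)) (by field_simp; ring)
    simp only [smul_eq_mul, mul_one, Real.log_one, mul_zero, zero_add] at hp' hv'
    have i1 : (S-p)/(S-1) + (p-1)/(S-1)*S = p := by field_simp; ring
    have i2 : (S-v)/(S-1) + (v-1)/(S-1)*S = v := by field_simp; ring
    rw [i1] at hp'; rw [i2] at hv'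
    have i3 : (p-1)/(S-1) + (v-1)/(S-1) = 1 := by rw [← add_div, hS]; rw [div_eq_one_iff_eq]; ring; linarith
    have : (p-1)/(S-1) * (S * Real.log S) + (v-1)/(S-1) * (S * Real.log S) = S * Real.log S := by
      rw [← add_mul, i3, one_mul]
    have hpv : p + v = S + 1 := by rw [hS]; ring
    have : (p+v) * Real.log S = (S+1) * Real.log S := by rw [hpv]
    nlinarith
  nlinarith

lemma polyB (w y : ℝ) (hy : 0 ≤ y) (hyw : y ≤ w) (hw : w ≤ 1/4) :
    (1-w)*(1+y)^2*(3*(1-w*y) + (1+w)*(2-y)^2) ≤ 6*(1-w*y)^3*(7/6-w/2+(43/20)*y) := by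
  obtain ⟨z, rfl⟩ : ∃ z, w = y + z := ⟨w - y, by ring⟩
  have hz : 0 ≤ z := by linarith
  have : 0 ≤ 1/4 - y - z := by linarith
  have hyz := mul_nonneg hy hz
  nlinarith [mul_nonneg hy this, mul_nonneg hyz this, mul_nonneg (mul_nonneg hy hy) this, mul_nonneg (mul_nonneg hyz hy) this, mul_nonneg hyz hy, mul_nonneg hyz hz, pow_nonneg hy 3, pow_nonneg hy 2, mul_nonneg (pow_nonneg hy 3) this, mul_nonneg (mul_nonneg hyz hyz) hy, mul_nonneg hyz (pow_nonneg hy 3), pow_nonneg hy 4, pow_nonneg hy 5, mul_nonneg hyz (pow_nonneg hy 2)]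

lemma log94 : 0.8109 ≤ Real.log (9/4) := by
  rw [show (9/4:ℝ) = 3^2/2^2 by norm_num, Real.log_div (by norm_num) (by norm_num), Real.log_pow, Real.log_pow]
  have := Real.log_two_lt_d9
  have := Real.log_three_gt_d9
  push_cast; linarith
lemma log98 : Real.log (9/8) ≤ 0.1178 := by
  rw [show (9/8:ℝ) = 3^2/2^3 by norm_num, Real.log_div (by norm_num) (by norm_num), Real.log_pow, Real.log_pow]
  have := Real.log_two_gt_d9
  have := Real.log_three_lt_d9
  push_cast; linarith
lemma log169 : Real.log (16/9) ≤ 0.5754 := by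
  rw [show (16/9:ℝ) = 2^4/3^2 by norm_num, Real.log_div (by norm_num) (by norm_num), Real.log_pow, Real.log_pow]
  have := Real.log_two_lt_d9
  have := Real.log_three_gt_d9
  push_cast; linarith
lemma log32 : Real.log (3/2) ≤ 0.4055 := by
  rw [Real.log_div (by norm_num) (by norm_num)]
  have := Real.log_two_gt_d9
  have := Real.log_three_lt_d9
  linarith
lemma log32' : 0.4054 ≤ Real.log (3/2) := by
  rw [Real.log_div (by norm_num) (by norm_num)]
  have := Real.log_two_lt_d9
  have := Real.log_three_gt_d9
  linarith
lemma log43 : Real.log (4/3) ≤ 0.2877 := by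
  rw [show (4/3:ℝ) = 2^2/3 by norm_num, Real.log_div (by norm_num) (by norm_num), Real.log_pow]
  have := Real.log_two_lt_d9
  have := Real.log_three_gt_d9
  push_cast; linarith

lemma TT_le (a L c : ℝ) (hL : 0 ≤ L) (hc : Real.log a ≤ c) : TT a L ≤ L * c + L^2/a - 2*L+1 := by
  unfold TT
  have := mul_le_mul_of_nonneg_left hc hL
  linarith

/-- The contribution of `k = 0`. -/
lemma k0_bound (y a c : ℝ) (hy : 0 ≤ y) (ha : 0 < a) (hc : Real.log a ≤ c) :
    (2+y) * 0.8109 - 9/4 + 1 - ((1+y) * c + (1+y)^2/a - 2*(1+y)+1) ≤ hh (2+y) - hh (1+y) := by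
  have h1 := hh_tangent (2+y) (9/4) (by linarith) (by norm_num)
  have h2 := hh_le_TT (1+y) a (by linarith) ha
  have h3 := TT_le a (1+y) c (by linarith) hc
  have h4 := mul_le_mul_of_nonneg_left log94 (show 0 ≤ 2+y by linarith)
  linarith

lemma numA (w y p2 q2 p3 q3 : ℝ) (hy : 0 ≤ y) (hyw : y ≤ w) (hw : w ≤ 1/4)
    (hq2 : 0 ≤ q2) (hqp2 : q2 ≤ p2) (hp2 : p2 ≤ 3/2+w/2+(19/20)*y)
    (hq3 : 0 ≤ q3) (hqp3 : q3 ≤ p3) (hp3 : p3 ≤ 7/6-w/2+(43/20)*y) :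
    0.092 ≤ hh (2+y) - hh (1+y) + (hh q2 - hh p2) + (hh q3 - hh p3) := by
  have a0 := k0_bound y (9/8) _ hy (by norm_num) log98
  have a2 := hh_drop q2 p2 _ (16/9) hq2 hqp2 hp2 (by norm_num)
  have a3 := hh_drop q3 p3 _ (3/2) hq3 hqp3 hp3 (by norm_num)
  have b2 := TT_le (16/9) (3/2+w/2+(19/20)*y) _ (by linarith) log169
  have b3 := TT_le (3/2) (7/6-w/2+(43/20)*y) _ (by linarith) log32
  have h1 : 0 ≤ w - y := by linarith
  have h2 : 0 ≤ 1/4 - w := by linarith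
  nlinarith [mul_nonneg hy h1, mul_nonneg hy h2, mul_nonneg h1 h2]

lemma numB (y p2 q2 p3 q3 : ℝ) (hy : 0 ≤ y) (hyw : y ≤ 1/5)
    (hq2 : 0 ≤ q2) (hqp2 : q2 ≤ p2) (hp2 : p2 ≤ 1.68 + 1.04*y)
    (hq3 : 0 ≤ q3) (hqp3 : q3 ≤ p3) (hp3 : p3 ≤ 0.927+2.4*y) :
    0.033 ≤ hh (2+y) - hh (1+y) + (hh q2 - hh p2) + (hh q3 - hh p3) := by
  have a0 := k0_bound y (9/8) _ hy (by norm_num) log98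
  have a2 := hh_drop q2 p2 _ (16/9) hq2 hqp2 hp2 (by norm_num)
  have a3 := hh_drop q3 p3 _ (3/2) hq3 hqp3 hp3 (by norm_num)
  have b2 := TT_le (16/9) (1.68 + 1.04*y) _ (by linarith) log169
  have b3 := TT_le (3/2) (0.927+2.4*y) _ (by linarith) log32
  have h1 : 0 ≤ 1/5 - y := by linarith
  nlinarith [mul_nonneg hy h1]

lemma numC (y v p2 q2 p3 q3 : ℝ) (hy : 1/5 ≤ y) (hyw : y ≤ 1/3) (hv : 0.9375+1.6875*y ≤ v)
    (hq2 : 0 ≤ q2) (hqp2 : q2 ≤ p2) (hp2 : p2 ≤ 1.688+0.94*y)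
    (hq3 : 0 ≤ q3) (hqp3 : q3 ≤ p3) (hp3 : p3 ≤ 0.816+2.93*y) :
    0.033 ≤ hh (2+y) - hh (1+y) + (hh v + 1) + (hh q2 - hh p2) + (hh q3 - hh p3) := by
  have a0 := k0_bound y (4/3) _ (by linarith) (by norm_num) log43
  have a1 := hh_tangent v (3/2) (by linarith) (by norm_num)
  have c1 : v * 0.4054 ≤ v * Real.log (3/2) := mul_le_mul_of_nonneg_left log32' (by linarith)
  have a2 := hh_drop q2 p2 _ 2 hq2 hqp2 hp2 (by norm_num)
  have a3 := hh_drop q3 p3 _ (16/9) hq3 hqp3 hp3 (by norm_num)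
  have b2 := TT_le 2 (1.688+0.94*y) 0.6932 (by linarith) (by linarith [Real.log_two_lt_d9])
  have b3 := TT_le (16/9) (0.816+2.93*y) _ (by linarith) log169
  have h1 : 0 ≤ 1/3 - y := by linarith
  have h0 : 0 ≤ y - 1/5 := by linarith
  nlinarith [mul_nonneg h0 h1]

lemma p2B (y : ℝ) (hy : 0 ≤ y) (hyw : y ≤ 1/5) :
    3*((1+y)/(3-y)) * (1 + (1+(1+y)/(3-y))*(1-y)^2/2) ≤ 1.68+1.04*y := by
  have : 0 < 3 - y := by linarith
  have e : 3*((1+y)/(3-y)) * (1 + (1+(1+y)/(3-y))*(1-y)^2/2) = (3*(1+y)*((3-y) + 2*(1-y)^2))/(3-y)^2 := by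
    field_simp; ring
  rw [e, div_le_iff₀ (by positivity)]
  nlinarith [pow_nonneg hy 2, pow_nonneg hy 3, mul_nonneg hy (sub_nonneg.2 hyw)]

lemma p2C (y : ℝ) (hy : 1/5 ≤ y) (hyw : y ≤ 1/3) :
    3*((1+y)/(3-y)) * (1 + (1+(1+y)/(3-y))*(1-y)^2/2) ≤ 1.688+0.94*y := by
  have : 0 < 3 - y := by linarith
  have e : 3*((1+y)/(3-y)) * (1 + (1+(1+y)/(3-y))*(1-y)^2/2) = (3*(1+y)*((3-y) + 2*(1-y)^2))/(3-y)^2 := by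
    field_simp; ring
  rw [e, div_le_iff₀ (by positivity)]
  have h0 : 0 ≤ y - 1/5 := by linarith
  nlinarith [mul_nonneg h0 (sub_nonneg.2 hyw), mul_nonneg (mul_nonneg h0 (sub_nonneg.2 hyw)) h0, sq_nonneg (y-0.26), mul_nonneg h0 (sq_nonneg (y-0.26)), mul_nonneg (sub_nonneg.2 hyw) (sq_nonneg (y-0.26))]

lemma p3B (y : ℝ) (hy : 0 ≤ y) (hyw : y ≤ 1/5) :
    3*((1+y)/(3-y))^2 * (1 + (1+(1+y)/(3-y))*(2-y)^2/3) ≤ 0.927+2.4*y := by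
  have : 0 < 3 - y := by linarith
  have e : 3*((1+y)/(3-y))^2 * (1 + (1+(1+y)/(3-y))*(2-y)^2/3) = ((1+y)^2*(3*(3-y) + 4*(2-y)^2))/(3-y)^3 := by
    field_simp; ring
  rw [e, div_le_iff₀ (by positivity)]
  nlinarith [pow_nonneg hy 2, pow_nonneg hy 3, mul_nonneg hy (sub_nonneg.2 hyw), mul_nonneg (pow_nonneg hy 2) (sub_nonneg.2 hyw), mul_nonneg (pow_nonneg hy 3) (sub_nonneg.2 hyw)]

lemma p3C (y : ℝ) (hy : 1/5 ≤ y) (hyw : y ≤ 1/3) :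
    3*((1+y)/(3-y))^2 * (1 + (1+(1+y)/(3-y))*(2-y)^2/3) ≤ 0.816+2.93*y := by
  have : 0 < 3 - y := by linarith
  have e : 3*((1+y)/(3-y))^2 * (1 + (1+(1+y)/(3-y))*(2-y)^2/3) = ((1+y)^2*(3*(3-y) + 4*(2-y)^2))/(3-y)^3 := by
    field_simp; ring
  rw [e, div_le_iff₀ (by positivity)]
  have h0 : 0 ≤ y - 1/5 := by linarith
  have h1 := sub_nonneg.2 hyw
  nlinarith [mul_nonneg h0 h1, mul_nonneg (mul_nonneg h0 h1) h0, mul_nonneg (mul_nonneg h0 h1) (mul_nonneg h0 h0), mul_nonneg (mul_nonneg h0 h1) (mul_nonneg h0 h1)]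

lemma vC (y : ℝ) (hy : 1/5 ≤ y) (hyw : y ≤ 1/3) : 0.9375+1.6875*y ≤ 3*((1+y)/(3-y)) := by
  have : 0 < 3 - y := by linarith
  rw [← mul_div_assoc, le_div_iff₀ this]
  nlinarith [sq_nonneg (y-1/3)]

noncomputable def PP (n : ℕ) (u m : ℝ) (j : ℕ) : ℝ :=
  (n.choose j : ℝ) * u ^ j * (1 + (1 + u) * ((j:ℝ) + 1 - m)^2 / ((j:ℝ) + 1))

noncomputable def QQ (n : ℕ) (u m : ℝ) (j : ℕ) : ℝ :=
  (n.choose j : ℝ) * u ^ j * (u * ((n:ℝ) - j) / ((j:ℝ) + 1) + (1 + u) * ((j:ℝ) + 1 - m)^2 / ((j:ℝ) + 1))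

lemma choose_step (n j : ℕ) (hj : j ≤ n) :
    (n.choose (j+1) : ℝ) * ((j:ℝ)+1) = n.choose j * ((n:ℝ) - j) := by
  have := Nat.choose_succ_right_eq n j
  rw [← Nat.cast_sub hj]
  exact_mod_cast this

lemma PQ_diff (n : ℕ) (u m : ℝ) (j : ℕ) (hj : j ≤ n) :
    PP n u m j - QQ n u m j = (n.choose j : ℝ) * u ^ j - (n.choose (j+1) : ℝ) * u ^ (j+1) := by
  have h := choose_step n j hj
  have h0 : (j:ℝ) + 1 ≠ 0 := by positivity
  have h2 : (n.choose (j+1) : ℝ) = n.choose j * ((n:ℝ) - j) / ((j:ℝ)+1) := by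
    rw [eq_div_iff h0, h]
  rw [h2]; unfold PP QQ; ring

lemma PQ_sum (n : ℕ) (u m : ℝ) :
    ∑ j ∈ Finset.range (n+1), (PP n u m j - QQ n u m j) = 1 := by
  rw [Finset.sum_congr rfl (fun j hj => PQ_diff n u m j (by simp at hj; omega))]
  rw [Finset.sum_range_sub' (fun j => (n.choose j : ℝ) * u ^ j)]
  simp

lemma pdist_eq (n j : ℕ) (t : ℝ) (hj : j ≤ n) (ht : 0 < t) (ht1 : t < 1) :
    pdist n (n - j) t = (1-t)^n/2 * PP n (t/(1-t)) (((n:ℝ)+1)*t) j ∧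
    qdist n (n - j) t = (1-t)^n/2 * QQ n (t/(1-t)) (((n:ℝ)+1)*t) j := by
  have hx : 0 < 1 - t := by linarith
  have hc : ((n+1).choose (n-j) : ℝ) = ((n:ℝ)+1) * n.choose j / ((j:ℝ)+1) := by
    rw [eq_div_iff (by positivity)]
    have h1 : (n+1).choose (n-j) = (n+1).choose (j+1) := by
      rw [← Nat.choose_symm (show j+1 ≤ n+1 by omega)]
      congr 1; omega
    rw [h1]
    have := Nat.add_one_mul_choose_eq n j
    exact_mod_cast this.symm
  have hs : n - (n - j) = j := by omega
  have hcast : ((n - j : ℕ) : ℝ) = (n:ℝ) - j := by rw [Nat.cast_sub hj]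
  have hpow : (1-t)^n = (1-t)^(n-j) * (1-t)^j := by rw [← pow_add]; congr 1; omega
  have h0 : (j:ℝ) + 1 ≠ 0 := by positivity
  have hn0 : (n:ℝ) + 1 ≠ 0 := by positivity
  unfold pdist qdist PP QQ
  rw [if_pos (Nat.sub_le n j), if_pos (Nat.sub_le n j), hc, hs, hcast, hpow, div_pow]
  constructor
  · field_simp
    ring
  · field_simp
    ring

lemma mul_log_scale (c y : ℝ) (hc : 0 < c) (hy : 0 ≤ y) :
    (c*y) * Real.logb 2 (c*y) = (c / Real.log 2) * (hh y + y * (Real.log c + 1)) := by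
  unfold hh Real.logb
  rcases hy.eq_or_lt with rfl | hy
  · simp
  rw [Real.log_mul hc.ne' hy.ne']; ring

lemma H_diff (n : ℕ) (t : ℝ) (ht : 0 < t) (ht1 : t < 1) 
    (hP : ∀ j ≤ n, 0 ≤ PP n (t/(1-t)) (((n:ℝ)+1)*t) j)
    (hQ : ∀ j ≤ n, 0 ≤ QQ n (t/(1-t)) (((n:ℝ)+1)*t) j) :
    shannonH n (fun ℓ => pdist n ℓ t) - shannonH n (fun ℓ => qdist n ℓ t) =
    ((1-t)^n/2) / Real.log 2 * (hh (1 + ((n:ℝ)+1)*t) - hh (((n:ℝ)+1)*t) +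
      ∑ j ∈ Finset.range (n+1), (hh (QQ n (t/(1-t)) (((n:ℝ)+1)*t) j) - hh (PP n (t/(1-t)) (((n:ℝ)+1)*t) j))) := by
  have hsum := PQ_sum n (t/(1-t)) (((n:ℝ)+1)*t)
  have hx : 0 < 1 - t := by linarith
  have hc : 0 < (1-t)^n/2 := by positivity
  have hm : 0 ≤ ((n:ℝ)+1)*t := by positivity
  have ep : ∀ j ∈ Finset.range (n+1), _ := fun j hj =>
    (pdist_eq n j t (by simp at hj; omega) ht ht1)
  have lp : pdist n (n+1) t = (1-t)^n/2 * (((n:ℝ)+1)*t) := by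
    unfold pdist; rw [if_neg (by omega)]; ring
  have lq : qdist n (n+1) t = (1-t)^n/2 * (1 + ((n:ℝ)+1)*t) := by
    unfold qdist; rw [if_neg (by omega)]; ring
  generalize hu : t/(1-t) = u at *
  generalize hmm : ((n:ℝ)+1)*t = m at *
  generalize hcc : (1-t)^n/2 = c at *
  have sp : ∑ ℓ ∈ Finset.range (n+1), pdist n ℓ t * Real.logb 2 (pdist n ℓ t) =
      ∑ j ∈ Finset.range (n+1), c / Real.log 2 * (hh (PP n u m j) + PP n u m j * (Real.log c + 1)) := by
    rw [← Finset.sum_range_reflect]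
    refine Finset.sum_congr rfl (fun j hj => ?_)
    rw [Nat.add_sub_cancel, (ep j hj).1, mul_log_scale _ _ hc (hP j (by simp at hj; omega))]
  have sq : ∑ ℓ ∈ Finset.range (n+1), qdist n ℓ t * Real.logb 2 (qdist n ℓ t) =
      ∑ j ∈ Finset.range (n+1), c / Real.log 2 * (hh (QQ n u m j) + QQ n u m j * (Real.log c + 1)) := by
    rw [← Finset.sum_range_reflect]
    refine Finset.sum_congr rfl (fun j hj => ?_)
    rw [Nat.add_sub_cancel, (ep j hj).2, mul_log_scale _ _ hc (hQ j (by simp at hj; omega))]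
  unfold shannonH
  rw [Finset.sum_range_succ _ (n+1), Finset.sum_range_succ _ (n+1), sp, sq]
  beta_reduce
  rw [lp, lq, mul_log_scale _ _ hc hm, mul_log_scale _ _ hc (by linarith)]
  rw [← Finset.mul_sum, ← Finset.mul_sum, Finset.sum_add_distrib, Finset.sum_add_distrib,
    ← Finset.sum_mul, ← Finset.sum_mul, Finset.sum_sub_distrib]
  rw [Finset.sum_sub_distrib] at hsum
  have : ∑ j ∈ Finset.range (n+1), PP n u m j = 1 + ∑ j ∈ Finset.range (n+1), QQ n u m j := by linarith
  rw [this]; ring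

/-- `b_j ≤ 1/j!` for `j ≥ 3`. -/
lemma b_anti (n : ℕ) (hn : 3 ≤ n) (u : ℝ) (hu : 0 ≤ u) (hu1 : ((n:ℝ)-1)*u ≤ 1) (j : ℕ) (hj : 1 ≤ j) (hjn : j ≤ n) :
    (n.choose (j+1) : ℝ) * u ^ (j+1) * ((j:ℝ)+1) ≤ (n.choose j : ℝ) * u ^ j := by
  have h := choose_step n j hjn
  have e : (n.choose (j+1) : ℝ) * u ^ (j+1) * ((j:ℝ)+1) = (n.choose j : ℝ) * u ^ j * (((n:ℝ) - j)*u) := by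
    rw [pow_succ]; linear_combination (u^j*u) * h
  rw [e]
  have hj' : (1:ℝ) ≤ j := by exact_mod_cast hj
  have : ((n:ℝ) - j)*u ≤ 1 := by nlinarith
  have h2 : 0 ≤ (n.choose j : ℝ) * u ^ j := by positivity
  nlinarith

lemma b_le (n : ℕ) (hn : 3 ≤ n) (u : ℝ) (hu : 0 ≤ u) (hu1 : ((n:ℝ)-1)*u ≤ 1) (i : ℕ) (hjn : i + 3 ≤ n) :
    (n.choose (i+3) : ℝ) * u ^ (i+3) * (2*(i+3)) ≤ 1 := by
  have hn' : (3:ℝ) ≤ n := by exact_mod_cast hn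
  induction i with
  | zero =>
    have h1 := choose_step n 1 (by omega)
    have h2 := choose_step n 2 (by omega)
    norm_num at h1 h2 ⊢
    have e : (n.choose 3 : ℝ) * 6 = n * (n-1)*(n-2) := by linear_combination 2*h2 + (n-2:ℝ) * h1
    have e2 : (n.choose 3 : ℝ) * u^3 * 6 = (n-1)*u * ((n*(n-2)) * u^2) := by linear_combination u^3*e
    have h3 : 0 ≤ ((n:ℝ)-1)*u := mul_nonneg (by linarith) hu
    have h4 : ((n*(n-2)) * u^2) ≤ (((n:ℝ)-1)*u)^2 := by nlinarith [sq_nonneg u]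
    have h5 : (((n:ℝ)-1)*u)^2 ≤ 1 := by nlinarith
    rw [e2]
    have h6 : (0:ℝ) ≤ ((n*(n-2)) * u^2) := by
      have : (0:ℝ) ≤ n - 2 := by linarith
      positivity
    nlinarith
  | succ i ih =>
    have ih := ih (by omega)
    have h := b_anti n hn u hu hu1 (i+3) (by omega) (by omega)
    push_cast at h ⊢
    have e : i + 1 + 3 = i + 3 + 1 := by ring
    rw [e]
    have h0 : 0 ≤ (n.choose (i+3) : ℝ) * u ^ (i+3) := by positivity
    have hi : (0:ℝ) ≤ i := by positivity
    nlinarith [mul_nonneg h0 hi]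

lemma PP_le_one (n : ℕ) (hn : 3 ≤ n) (u m : ℝ) (hu : 0 ≤ u) (hu1 : ((n:ℝ)-1)*u ≤ 1)
    (hm : 1 ≤ m) (hm2 : m ≤ 2) (i : ℕ) (hjn : i + 3 ≤ n) : PP n u m (i+3) ≤ 1 := by
  have hb := b_le n hn u hu hu1 i hjn
  have hn' : (3:ℝ) ≤ n := by exact_mod_cast hn
  have hu2 : u ≤ 1/2 := by nlinarith
  unfold PP
  set b := (n.choose (i+3) : ℝ) * u ^ (i+3) with hbdef
  have h0 : 0 ≤ b := by positivity
  push_cast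
  have hi : (0:ℝ) ≤ i := by positivity
  have hk : (1 + (1 + u) * ((i:ℝ) + 3 + 1 - m)^2 / ((i:ℝ) + 3 + 1)) ≤ 2*(i+3) := by
    have h1 : ((i:ℝ) + 3 + 1 - m)^2 ≤ (i+3)^2 := by
      apply pow_le_pow_left₀ <;> linarith
    have h2 : (1 + u) * ((i:ℝ) + 3 + 1 - m)^2 ≤ 3/2 * (i+3)^2 := mul_le_mul (by linarith) h1 (by positivity) (by norm_num)
    have h3 : (1 + u) * ((i:ℝ) + 3 + 1 - m)^2 / ((i:ℝ) + 3 + 1) ≤ 2*(i+3) - 1 := by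
      rw [div_le_iff₀ (by positivity)]
      nlinarith
    linarith
  exact (mul_le_mul_of_nonneg_left hk h0).trans hb

lemma G_bound (n : ℕ) (hn : 3 ≤ n) (y u : ℝ) (hy : 0 ≤ y) (hyn : y ≤ 1/(n:ℝ)) (hu : u = (1+y)/(n-y)) :
    (∀ j ≤ n, 0 ≤ PP n u (1+y) j) ∧ (∀ j ≤ n, 0 ≤ QQ n u (1+y) j) ∧
    (if n = 3 then 0.033 else 0.092) ≤ hh (2 + y) - hh (1+y) +
      ∑ j ∈ Finset.range (n+1), (hh (QQ n u (1+y) j) - hh (PP n u (1+y) j)) := by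
  have hn' : (3:ℝ) ≤ n := by exact_mod_cast hn
  have hy3 : y ≤ 1/3 := hyn.trans (one_div_le_one_div_of_le (by norm_num) hn')
  have hny : (n:ℝ)*y ≤ 1 := by
    rw [le_div_iff₀ (by linarith)] at hyn; linarith
  have hd : 0 < (n:ℝ) - y := by linarith
  have hu0 : 0 < u := by rw [hu]; positivity
  have hue : u * (n-y) = 1+y := by rw [hu]; field_simp
  have hu1 : ((n:ℝ)-1)*u ≤ 1 := by
    rw [hu, ← mul_div_assoc, div_le_one hd]; nlinarith
  have hv1 : 1 ≤ n*u := by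
    rw [hu, ← mul_div_assoc, le_div_iff₀ hd]; nlinarith
  have hP : ∀ j ≤ n, 0 ≤ PP n u (1+y) j := by
    intro j hj; unfold PP; positivity
  have hQ : ∀ j ≤ n, 0 ≤ QQ n u (1+y) j := by
    intro j hj; unfold QQ
    have : (0:ℝ) ≤ n - j := by
      have : (j:ℝ) ≤ n := by exact_mod_cast hj
      linarith
    positivity
  refine ⟨hP, hQ, ?_⟩
  have hQP : ∀ j, 1 ≤ j → j ≤ n → QQ n u (1+y) j ≤ PP n u (1+y) j := by
    intro j h1 hj
    have a := b_anti n hn u hu0.le hu1 j h1 hj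
    have b := PQ_diff n u (1+y) j hj
    have h0 : 0 ≤ (n.choose (j+1) : ℝ) * u ^ (j+1) := by positivity
    have : (0:ℝ) ≤ j := by positivity
    nlinarith
  have htail : 0 ≤ ∑ j ∈ Finset.range (n-2), (hh (QQ n u (1+y) (j+3)) - hh (PP n u (1+y) (j+3))) := by
    apply Finset.sum_nonneg
    intro j hj
    simp only [Finset.mem_range] at hj
    have := hh_anti _ _ (hQ (j+3) (by omega)) (hQP (j+3) (by omega) (by omega))
      (PP_le_one n hn u (1+y) hu0.le hu1 (by linarith) (by linarith) j (by omega))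
    linarith
  have e : n + 1 = (n-2) + 1 + 1 + 1 := by omega
  rw [e, Finset.sum_range_succ', Finset.sum_range_succ', Finset.sum_range_succ']
  simp only [add_assoc, Nat.reduceAdd, zero_add]
  have P0 : PP n u (1+y) 0 = 1 + (1+u)*y^2 := by simp [PP]
  have Q0 : QQ n u (1+y) 0 = PP n u (1+y) 0 + (n*u - 1) := by
    have := PQ_diff n u (1+y) 0 (by omega)
    simp at this
    linarith
  have k1 := hh_incr (PP n u (1+y) 0) (n*u) (by rw [P0]; nlinarith [sq_nonneg y]) hv1
  rw [← Q0] at k1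
  have kv := hh_ge (n*u) (by linarith)
  have c2 : (n.choose 2 : ℝ) = n*(n-1)/2 := Nat.cast_choose_two ℝ n
  have P1 : PP n u (1+y) 1 = n*u*(1+(1+u)*(1-y)^2/2) := by
    unfold PP; rw [Nat.choose_one_right]; push_cast; ring
  have P2 : PP n u (1+y) 2 = n*(n-1)/2*u^2*(1+(1+u)*(2-y)^2/3) := by
    unfold PP; rw [c2]; push_cast; ring
  have q1 := hQ 1 (by omega)
  have q2 := hQ 2 (by omega)
  have r1 := hQP 1 (by omega) (by omega)
  have r2 := hQP 2 (by omega) (by omega)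
  split_ifs with h3
  · subst h3
    norm_num at P1 P2 hu k1 kv
    rcases le_total y (1/5) with h | h
    · have := numB y _ _ _ _ hy h q1 r1 (by rw [P1, hu]; exact p2B y hy h) q2 r2 (by rw [P2, hu]; exact p3B y hy h)
      linarith
    · have := numC y (3*u) _ _ _ _ h hy3 (by rw [hu]; exact vC y h hy3) q1 r1 (by rw [P1, hu]; exact p2C y h hy3) q2 r2 (by rw [P2, hu]; exact p3C y h hy3)
      linarith
  · have hn4 : (4:ℝ) ≤ n := by
      have : 4 ≤ n := by omega
      exact_mod_cast this
    have hw : 1/(n:ℝ) ≤ 1/4 := one_div_le_one_div_of_le (by norm_num) hn4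
    have B1 := polyA (1/n) y hy hyn hw
    have B2 := polyB (1/n) y hy hyn hw
    have hdw : 0 < 1 - 1/(n:ℝ)*y := by nlinarith
    have hn0 : (n:ℝ) ≠ 0 := by linarith
    have hnd : (n:ℝ) - y = n * (1 - 1/(n:ℝ)*y) := by field_simp
    have L1 : PP n u (1+y) 1 ≤ 3/2+(1/n)/2+(19/20)*y := by
      rw [P1, hu, hnd]
      generalize hdd : 1 - 1/(n:ℝ)*y = d at *
      have e1 : (1 + (1+y)/(n*d)) = (1 + 1/n)/d := by
        field_simp; rw [← hdd]; field_simp; ring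
      rw [e1]
      have e2 : (n:ℝ)*((1+y)/(n*d))*(1 + (1+1/n)/d*(1-y)^2/2) = (2*(1+y)*d + (1+y)*(1+1/n)*(1-y)^2)/(2*d^2) := by
        field_simp
      rw [e2, div_le_iff₀ (by positivity)]
      linarith
    have L2 : PP n u (1+y) 2 ≤ 7/6-(1/n)/2+(43/20)*y := by
      rw [P2, hu, hnd]
      generalize hdd : 1 - 1/(n:ℝ)*y = d at *
      have e1 : (1 + (1+y)/(n*d)) = (1 + 1/n)/d := by
        field_simp; rw [← hdd]; field_simp; ring
      rw [e1]
      have e2 : (n:ℝ)*(n-1)/2*((1+y)/(n*d))^2*(1 + (1+1/n)/d*(2-y)^2/3) = ((1-1/n)*(1+y)^2*(3*d+(1+1/n)*(2-y)^2))/(6*d^3) := by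
        field_simp
        ring
      rw [e2, div_le_iff₀ (by positivity)]
      linarith
    have := numA (1/n) y _ _ _ _ hy hyn hw q1 r1 L1 q2 r2 L2
    linarith

lemma pow_mono_bound (n : ℕ) (hn : 3 ≤ n) : (8:ℝ)/27 ≤ (1 - 1/(n:ℝ))^n := by
  induction n, hn using Nat.le_induction with
  | base => norm_num
  | succ n hn ih =>
    refine ih.trans ?_
    have hn' : (3:ℝ) ≤ n := by exact_mod_cast hn
    have hn1 : (0:ℝ) < n - 1 := by linarith
    have hB := one_add_mul_le_pow (a := 1/((n:ℝ)^2-1)) (by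
      have : 0 ≤ 1/((n:ℝ)^2-1) := by apply div_nonneg <;> nlinarith
      linarith) (n+1)
    have hs : (0:ℝ) < n^2 - 1 := by nlinarith
    have e1 : 1 + ((n+1:ℕ):ℝ) * (1/((n:ℝ)^2-1)) = n/(n-1) := by
      rw [show (n:ℝ)^2 - 1 = (n-1)*(n+1) by ring]; push_cast; field_simp; ring
    have e2 : 1 + 1/((n:ℝ)^2-1) = (1 - 1/((n+1:ℕ):ℝ)) / (1 - 1/(n:ℝ)) := by
      have : 1 - 1/(n:ℝ) = (n-1)/n := by field_simp
      rw [this, show (n:ℝ)^2 - 1 = (n-1)*(n+1) by ring]; push_cast; field_simp; ring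
    rw [e1, e2, div_pow] at hB
    have hx : 0 < 1 - 1/(n:ℝ) := by
      have : 1 - 1/(n:ℝ) = (n-1)/n := by field_simp
      rw [this]; positivity
    rw [le_div_iff₀ (by positivity), pow_succ (1 - 1/(n:ℝ))] at hB
    have e3 : (n:ℝ)/(n-1) * ((1 - 1/(n:ℝ))^n * (1 - 1/(n:ℝ))) = (1 - 1/(n:ℝ))^n := by
      have : (n:ℝ)/(n-1) * (1 - 1/(n:ℝ)) = 1 := by field_simp
      linear_combination (1 - 1/(n:ℝ))^n * this
    rw [e3] at hB
    exact hB

lemma K_bound (n : ℕ) (hn : 3 ≤ n) :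
    4 * (((n : ℝ) + 1) * ((n : ℝ) - 2) / (4 * (n : ℝ) * ((n : ℝ) - 1))) ^ 2 * (1 - 1/(n:ℝ))^n ≤
      (if n = 3 then 0.033 else 0.092) := by
  split_ifs with h
  · subst h; norm_num
  have hn' : (3:ℝ) ≤ n := by exact_mod_cast hn
  have hA : ((n : ℝ) + 1) * ((n : ℝ) - 2) / (4 * (n : ℝ) * ((n : ℝ) - 1)) ≤ 1/4 := by
    rw [div_le_iff₀ (by nlinarith)]; nlinarith
  have hA0 : 0 ≤ ((n : ℝ) + 1) * ((n : ℝ) - 2) / (4 * (n : ℝ) * ((n : ℝ) - 1)) :=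
    div_nonneg (by nlinarith) (by nlinarith)
  have h2 := Real.one_sub_div_pow_le_exp_neg (n := n) (t := 1) (by linarith)
  have h3 : Real.exp (-1) ≤ 0.368 := by
    linarith [Real.exp_neg_one_lt_d9]
  have h4 : (((n : ℝ) + 1) * ((n : ℝ) - 2) / (4 * (n : ℝ) * ((n : ℝ) - 1)))^2 ≤ (1/4)^2 := pow_le_pow_left₀ hA0 hA 2
  have h5 : (0:ℝ) ≤ (1 - 1/(n:ℝ))^n := by
    have := pow_mono_bound n hn; linarith
  calc _ ≤ 4 * (1/4)^2 * (0.368:ℝ) := mul_le_mul (by linarith) (h2.trans h3) h5 (by norm_num)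
    _ = _ := by norm_num

theorem entropy_difference_lower_bound (n : ℕ) (hn : 3 ≤ n) (t : ℝ)
    (h1 : 1 / ((n : ℝ) + 1) ≤ t) (h2 : t ≤ 1 / (n : ℝ)) :
    (2 / Real.log 2) * (((n : ℝ) + 1) * ((n : ℝ) - 2) / (4 * (n : ℝ) * ((n : ℝ) - 1))) ^ 2 *
        (1 - 1 / (n : ℝ)) ^ (2 * n)
      ≤ shannonH n (fun ℓ => pdist n ℓ t) - shannonH n (fun ℓ => qdist n ℓ t) ∧
    32 / (6561 * Real.log 2)
      ≤ (2 / Real.log 2) * (((n : ℝ) + 1) * ((n : ℝ) - 2) / (4 * (n : ℝ) * ((n : ℝ) - 1))) ^ 2 *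
        (1 - 1 / (n : ℝ)) ^ (2 * n) ∧
    0 < 32 / (6561 * Real.log 2) := by
  have hl : 0 < Real.log 2 := Real.log_pos (by norm_num)
  have hn' : (3:ℝ) ≤ n := by exact_mod_cast hn
  have hpm := pow_mono_bound n hn
  refine ⟨?_, ?_, by positivity⟩
  · have ht : 0 < t := lt_of_lt_of_le (by positivity) h1
    have hn3 : 1/(n:ℝ) ≤ 1/3 := one_div_le_one_div_of_le (by norm_num) hn'
    have ht1 : t < 1 := by linarith
    have hx : 0 < 1 - t := by linarith
    obtain ⟨y, hy⟩ : ∃ y, ((n:ℝ)+1)*t = 1 + y := ⟨((n:ℝ)+1)*t - 1, by ring⟩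
    have hy0 : 0 ≤ y := by
      rw [div_le_iff₀ (by positivity)] at h1; linarith
    have hyn : y ≤ 1/(n:ℝ) := by
      have h3 := mul_le_mul_of_nonneg_left h2 (show (0:ℝ) ≤ n+1 by positivity)
      have : ((n:ℝ)+1)*(1/n) = 1 + 1/n := by field_simp
      linarith
    have hu : t/(1-t) = (1+y)/(n-y) := by
      have : (n:ℝ) - y = (n+1)*(1-t) := by linarith
      rw [this, ← hy]; field_simp
    obtain ⟨hP, hQ, hG⟩ := G_bound n hn y (t/(1-t)) hy0 hyn hu
    rw [← hy] at hP hQ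
    rw [H_diff n t ht ht1 hP hQ, hy]
    rw [show 1 + (1 + y) = 2 + y by ring]
    have hK := (K_bound n hn).trans hG
    set G := hh (2 + y) - hh (1+y) +
      ∑ j ∈ Finset.range (n+1), (hh (QQ n (t/(1-t)) (1+y) j) - hh (PP n (t/(1-t)) (1+y) j))
    have hc : (1 - 1/(n:ℝ))^n ≤ (1-t)^n := pow_le_pow_left₀ (by linarith) (by linarith) n
    set A := (((n : ℝ) + 1) * ((n : ℝ) - 2) / (4 * (n : ℝ) * ((n : ℝ) - 1))) ^ 2
    set X := (1 - 1/(n:ℝ))^n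
    have hX : (1 - 1/(n:ℝ))^(2*n) = X * X := by rw [two_mul, pow_add]
    have hA : 0 ≤ A := by positivity
    have hX0 : 0 ≤ X := by linarith
    rw [hX]
    have : X * (4*A*X) ≤ (1-t)^n * G := mul_le_mul hc hK (by positivity) (by positivity)
    have e1 : 2 / Real.log 2 * A * (X*X) = (X*(4*A*X)) / (2*Real.log 2) := by field_simp; ring
    have e2 : (1-t)^n/2/Real.log 2 * G = ((1-t)^n*G)/(2*Real.log 2) := by field_simp
    rw [e1, e2]
    gcongr
  · have hA : 1/6 ≤ ((n : ℝ) + 1) * ((n : ℝ) - 2) / (4 * (n : ℝ) * ((n : ℝ) - 1)) := by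
      rw [le_div_iff₀ (by nlinarith)]; nlinarith
    have h4 := pow_le_pow_left₀ (by norm_num) hA 2
    have h5 := pow_le_pow_left₀ (by norm_num) hpm 2
    rw [← pow_mul, mul_comm n 2] at h5
    have e : 32 / (6561 * Real.log 2) = 2/Real.log 2 * (1/6)^2 * (8/27)^2 := by
      field_simp; norm_num
    rw [e]
    gcongr
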